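/- Let α0,α1,α2,α3,α4 be complex numbers with α0+α1+2α2+2α3+2α4=1, and let (x,y,z,w) be a rational solution of the Sasano system B4(α0,α1,α2,α3,α4). Let h_{∞,0} denote the constant term of the Laurent expansion in powers of 1/t at t=∞ of the Hamiltonian H_{B4}(t) evaluated along the solution, and let h_{0,0} denote the constant term of the Laurent expansion of H_{B4}(t) at t=0. Then h_{∞,0} − h_{0,0} is an integer. -/

import Mathlib

open Filter Topology Polynomial

noncomputable section

/-- The four equations of the Sasano system of type `B₄⁽¹⁾` at the point `t`. -/
def B4Eqs (a0 a1 a2 a3 a4 : ℂ) (x y z w : ℂ → ℂ) (t : ℂ) : Prop :=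
  (t * deriv x t =
      2 * x t ^ 2 * y t - x t ^ 2 + (1 - 2*a2 - 2*a3 - 2*a4) * x t
        + 2 * a3 * z t + 2 * z t ^ 2 * w t + t) ∧
  (t * deriv y t =
      -2 * x t * y t ^ 2 + 2 * x t * y t - (1 - 2*a2 - 2*a3 - 2*a4) * y t + a1) ∧
  (t * deriv z t =
      2 * z t ^ 2 * w t - z t ^ 2 + (1 - 2*a4) * z t + 2 * y t * z t ^ 2 + t) ∧
  (t * deriv w t =
      -2 * z t * w t ^ 2 + 2 * z t * w t - (1 - 2*a4) * w t
        - 2 * a3 * y t - 4 * y t * z t * w t + a3)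

/-- A complex rational function: a quotient of two polynomials (with junk value `0`
at poles), regarded as a function on `ℂ`. -/
def IsRatFn (f : ℂ → ℂ) : Prop :=
  ∃ p q : Polynomial ℂ, q ≠ 0 ∧ ∀ t : ℂ, f t = p.eval t / q.eval t

/-- A rational solution of the Sasano system `B₄⁽¹⁾`: a quadruple of rational functions
satisfying the four equations outside a finite set. -/
def IsRatSolB4 (a0 a1 a2 a3 a4 : ℂ) (x y z w : ℂ → ℂ) : Prop :=
  IsRatFn x ∧ IsRatFn y ∧ IsRatFn z ∧ IsRatFn w ∧
    ∃ S : Set ℂ, S.Finite ∧ ∀ t ∉ S, B4Eqs a0 a1 a2 a3 a4 x y z w t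

/-- The Hamiltonian `H_{B₄⁽¹⁾}` evaluated along a solution `(x,y,z,w)`. -/
def HB4 (a1 a2 a3 a4 : ℂ) (x y z w : ℂ → ℂ) (t : ℂ) : ℂ :=
  x t ^ 2 * y t * (y t - 1) + x t * ((1 - 2*a2 - 2*a3 - 2*a4) * y t - a1) + t * y t
    + z t ^ 2 * w t * (w t - 1) + z t * ((1 - 2*a4) * w t - a3) + t * w t
    + 2 * y t * z t * (z t * w t + a3)
/-- The filter of neighbourhoods of `t = ∞` in `ℂ`. -/
def atInfty : Filter ℂ := Filter.comap (fun t : ℂ => ‖t‖) Filter.atTop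

/-- `h` is the constant term of the Laurent expansion of `f` in powers of `1/t` at
`t = ∞`: after subtracting a polynomial with zero constant coefficient, `f` tends
to `h` as `t → ∞`. -/
def HasConstTermAtInfty (f : ℂ → ℂ) (h : ℂ) : Prop :=
  ∃ p : Polynomial ℂ, p.coeff 0 = 0 ∧
    Tendsto (fun t => f t - p.eval t) atInfty (𝓝 h)

/-- `h` is the constant term of the Laurent expansion of `f` at `t = 0`: after
subtracting a principal part, `f` tends to `h` as `t → 0`. -/
def HasConstTermAtZero (f : ℂ → ℂ) (h : ℂ) : Prop :=
  ∃ (n : ℕ) (a : ℕ → ℂ),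
    Tendsto (fun t => f t - ∑ k ∈ Finset.range n, a k / t ^ (k + 1)) (𝓝[≠] 0) (𝓝 h)

/-- A meromorphic function is either analytic or the inverse of an analytic function
vanishing at the point. -/
lemma mero_dich {f : ℂ → ℂ} {c : ℂ} (hf : MeromorphicAt f c) :
    (∃ g : ℂ → ℂ, AnalyticAt ℂ g c ∧ ∀ᶠ t in 𝓝[≠] c, f t = g t) ∨
    (∃ g : ℂ → ℂ, AnalyticAt ℂ g c ∧ g c = 0 ∧ ∀ᶠ t in 𝓝[≠] c, f t * g t = 1) := by
  by_cases htop : meromorphicOrderAt f c = ⊤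
  · left
    rw [meromorphicOrderAt_eq_top_iff] at htop
    exact ⟨fun _ => 0, analyticAt_const, htop⟩
  · obtain ⟨n, hn⟩ := WithTop.ne_top_iff_exists.mp htop
    obtain ⟨g, hg, hgc, hfg⟩ := (meromorphicOrderAt_eq_int_iff hf).mp hn.symm
    have hne : ∀ᶠ t in 𝓝[≠] c, t ≠ c := eventually_mem_nhdsWithin
    rcases le_or_gt 0 n with h0 | h0
    · left
      obtain ⟨m, rfl⟩ := Int.eq_ofNat_of_zero_le h0
      refine ⟨fun t => (t - c) ^ m * g t, by fun_prop, ?_⟩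
      filter_upwards [hfg] with t ht
      simpa using ht
    · right
      obtain ⟨m, hm⟩ := Int.eq_ofNat_of_zero_le (show 0 ≤ -n by omega)
      have hm0 : m ≠ 0 := by omega
      have hn' : n = -(m : ℤ) := by omega
      refine ⟨fun t => (t - c) ^ m * (g t)⁻¹, ?_, by simp [hm0], ?_⟩
      · exact AnalyticAt.mul (by fun_prop) (hg.inv hgc)
      · have hg0 : ∀ᶠ t in 𝓝[≠] c, g t ≠ 0 :=
          (hg.continuousAt.eventually_ne hgc).filter_mono nhdsWithin_le_nhds
        filter_upwards [hfg, hne, hg0] with t ht h1 h2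
        rw [ht, hn', zpow_neg, zpow_natCast, smul_eq_mul]
        have h3 : t - c ≠ 0 := sub_ne_zero.mpr h1
        field_simp

lemma deriv_ev {f g : ℂ → ℂ} {c : ℂ} (h : ∀ᶠ t in 𝓝[≠] c, f t = g t) :
    ∀ᶠ t in 𝓝[≠] c, deriv f t = deriv g t :=
  Filter.EventuallyEq.nhdsNE_deriv h

/-- Two functions continuous at `c` agreeing near `c` agree at `c`. -/
lemma eq_at {F G : ℂ → ℂ} {c : ℂ} (hF : ContinuousAt F c) (hG : ContinuousAt G c)
    (h : ∀ᶠ t in 𝓝[≠] c, F t = G t) : F c = G c := by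
  have h1 : Tendsto F (𝓝[≠] c) (𝓝 (F c)) := hF.tendsto.mono_left nhdsWithin_le_nhds
  have h2 : Tendsto G (𝓝[≠] c) (𝓝 (G c)) := hG.tendsto.mono_left nhdsWithin_le_nhds
  exact tendsto_nhds_unique (h1.congr' h) h2

lemma mero_diff {f : ℂ → ℂ} {c : ℂ} (hf : MeromorphicAt f c) :
    ∀ᶠ t in 𝓝[≠] c, DifferentiableAt ℂ f t :=
  hf.eventually_analyticAt.mono fun _ h => h.differentiableAt

lemma ana_diff {f : ℂ → ℂ} {c : ℂ} (hf : AnalyticAt ℂ f c) :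
    ∀ᶠ t in 𝓝[≠] c, DifferentiableAt ℂ f t :=
  mero_diff hf.meromorphicAt

/-- If a product of two functions is eventually one, the logarithmic derivatives are opposite. -/
lemma deriv_inv_ev {f g : ℂ → ℂ} {c : ℂ} (hf : MeromorphicAt f c) (hg : AnalyticAt ℂ g c)
    (h : ∀ᶠ t in 𝓝[≠] c, f t * g t = 1) :
    ∀ᶠ t in 𝓝[≠] c, deriv f t * g t + f t * deriv g t = 0 := by
  have h1 := deriv_ev (f := fun t => f t * g t) (g := fun _ => 1) h
  filter_upwards [h1, mero_diff hf, ana_diff hg] with t h1 h2 h3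
  rw [deriv_fun_mul h2 h3] at h1
  simpa using h1

/-- Dichotomy for `z`: analytic and vanishing, or inverse of an analytic function. -/
lemma mero_dich' {f : ℂ → ℂ} {c : ℂ} (hf : MeromorphicAt f c) :
    (∃ g : ℂ → ℂ, AnalyticAt ℂ g c ∧ g c = 0 ∧ ∀ᶠ t in 𝓝[≠] c, f t = g t) ∨
    (∃ g : ℂ → ℂ, AnalyticAt ℂ g c ∧ ∀ᶠ t in 𝓝[≠] c, f t * g t = 1) := by
  rcases mero_dich hf with ⟨g, hg, h⟩ | ⟨g, hg, _, h⟩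
  · by_cases hc : g c = 0
    · exact Or.inl ⟨g, hg, hc, h⟩
    · right
      refine ⟨fun t => (g t)⁻¹, hg.inv hc, ?_⟩
      have hg0 : ∀ᶠ t in 𝓝[≠] c, g t ≠ 0 :=
        (hg.continuousAt.eventually_ne hc).filter_mono nhdsWithin_le_nhds
      filter_upwards [h, hg0] with t h1 h2
      rw [h1, mul_inv_cancel₀ h2]
  · exact Or.inr ⟨g, hg, h⟩

/-- Algebraic part of the local analysis. -/
lemma final_alg {c k S W Y : ℂ} (hc : c ≠ 0) (hk : k = 2 * S + c) (hS : S = W + Y)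
    (hW : W * (W + c) = 0)
    (hX : Y = 0 ∨ ∃ X : ℂ, Y * (2 * W + (2 - X) * Y + c) = 0 ∧
      (1 - X) * (2 * W + c - 2 * X * Y) = 0) :
    k ≠ 0 ∧ ∃ n : ℤ, S * c = -(n * k ^ 2) := by
  have main : k = c ∨ k = -c ∨ 2 * k = c ∨ 2 * k = -c := by
    have hY0 : Y = 0 → k = c ∨ k = -c ∨ 2 * k = c ∨ 2 * k = -c := by
      intro h
      rcases mul_eq_zero.mp hW with h1 | h1
      · left; rw [hk, hS, h, h1]; ring
      · right; left; linear_combination hk + 2 * hS + 2 * h + 2 * h1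
    rcases hX with h | ⟨X, h1, h2⟩
    · exact hY0 h
    rcases mul_eq_zero.mp h1 with h1 | h1
    · exact hY0 h1
    rcases mul_eq_zero.mp h2 with h2 | h2
    · have hX1 : X = 1 := by linear_combination -h2
      subst hX1
      rcases mul_eq_zero.mp hW with h3 | h3
      · right; left; linear_combination hk + 2 * hS + 2 * h1 - 2 * h3
      · left; linear_combination hk + 2 * hS + 2 * h1 - 2 * h3
    · have h4 : 4 * Y = -(2 * W + c) := by linear_combination 2 * h1 - h2
      rcases mul_eq_zero.mp hW with h3 | h3
      · right; right; left; linear_combination 2 * hk + 4 * hS + h4 + 2 * h3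
      · right; right; right; linear_combination 2 * hk + 4 * hS + h4 + 2 * h3
  have hSk : S = (k - c) / 2 := by linear_combination -hk / 2
  rcases main with h | h | h | h
  · exact ⟨by rw [h]; exact hc, 0, by rw [hSk, h]; push_cast; ring⟩
  · exact ⟨by rw [h]; exact neg_ne_zero.mpr hc, 1, by rw [hSk, h]; push_cast; ring⟩
  · have h' : c = 2 * k := h.symm
    exact ⟨fun h0 => hc (by rw [h', h0, mul_zero]), 1, by rw [hSk, h']; push_cast; ring⟩
  · have h' : c = -(2 * k) := by rw [h]; ring
    exact ⟨fun h0 => hc (by rw [h', h0]; ring), 3, by rw [hSk, h']; push_cast; ring⟩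

lemma local_q {a0 a1 a2 a3 a4 : ℂ} {x y z w : ℂ → ℂ} {c : ℂ} (hc : c ≠ 0)
    (mx : MeromorphicAt x c) (my : MeromorphicAt y c) (mz : MeromorphicAt z c)
    (mw : MeromorphicAt w c)
    (heq : ∀ᶠ t in 𝓝[≠] c, B4Eqs a0 a1 a2 a3 a4 x y z w t) :
    ∃ n : ℤ, Tendsto (fun t => (t - c) ^ 2 * (y t + w t)) (𝓝[≠] c) (𝓝 (-(n * c))) := by
  have hne : ∀ᶠ t in 𝓝[≠] c, t ≠ c := eventually_mem_nhdsWithin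
  have ht0 : ∀ᶠ t in 𝓝[≠] c, t ≠ 0 :=
    (continuousAt_id.eventually_ne hc).filter_mono nhdsWithin_le_nhds
  rcases mero_dich' mz with ⟨Z, hZ, hZ0, hzZ⟩ | ⟨ζ, hζ, hzζ⟩
  swap
  · -- `z` does not vanish: `y + w` is regular
    refine ⟨0, ?_⟩
    have hdζ := hζ.deriv
    set R : ℂ → ℂ := fun t => (t - c) ^ 2 *
      ((1 - t * deriv ζ t - (1 - 2 * a4) * ζ t - t * ζ t ^ 2) / 2) with hR
    have hRc : ContinuousAt R c := by
      have := hζ.continuousAt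
      have := hdζ.continuousAt
      fun_prop
    have h1 : Tendsto R (𝓝[≠] c) (𝓝 (R c)) := hRc.tendsto.mono_left nhdsWithin_le_nhds
    have h2 : R c = -(((0 : ℤ) : ℂ) * c) := by simp [hR]
    rw [h2] at h1
    refine h1.congr' ?_
    filter_upwards [heq, hzζ, deriv_inv_ev mz hζ hzζ] with t ⟨_, _, e3, _⟩ e1 e2
    simp only [hR]
    have e4 : y t + w t = (1 - t * deriv ζ t - (1 - 2 * a4) * ζ t - t * ζ t ^ 2) / 2 := by
      have hz0 : z t ≠ 0 := left_ne_zero_of_mul_eq_one e1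
      have hζe : ζ t = (z t)⁻¹ := eq_inv_of_mul_eq_one_right e1
      have hd : deriv ζ t = - deriv z t * (z t)⁻¹ ^ 2 := by
        rw [hζe] at e2
        field_simp at e2 ⊢
        linear_combination e2
      rw [hd, hζe]
      field_simp
      linear_combination -e3
    rw [e4]
  · have hZc := hZ.continuousAt
    have hdZ := hZ.deriv
    have hdZc := hdZ.continuousAt
    have hdz := deriv_ev hzZ
    -- `z` does not vanish near `c`
    have hz0 : ∀ᶠ t in 𝓝[≠] c, z t ≠ 0 := by
      rcases hZ.eventually_eq_zero_or_eventually_ne_zero with h | h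
      · exfalso
        have h1 : ∀ᶠ t in 𝓝[≠] c, z t = (fun _ => (0 : ℂ)) t := by
          filter_upwards [hzZ, h.filter_mono nhdsWithin_le_nhds] with t h1 h2
          rw [h1, h2]
        have h2 : ∀ᶠ t in 𝓝[≠] c, False := by
          filter_upwards [h1, deriv_ev h1, heq, ht0] with t h1 h2 ⟨_, _, h3, _⟩ h4
          rw [h1, h2] at h3
          simp at h3
          exact h4 h3.symm
        exact h2.exists.choose_spec
      · filter_upwards [hzZ, h] with t h1 h2
        rw [h1]; exact h2
    -- `S = z² (y + w)` is regular
    set S : ℂ → ℂ := fun t => (t * deriv Z t - (1 - 2 * a4) * Z t - t + Z t ^ 2) / 2 with hSdef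
    have hS : AnalyticAt ℂ S c := by fun_prop
    have hSc := hS.continuousAt
    have hSe : ∀ᶠ t in 𝓝[≠] c, z t ^ 2 * (y t + w t) = S t := by
      filter_upwards [heq, hzZ, hdz] with t ⟨_, _, e3, _⟩ e1 e2
      simp only [hSdef, ← e1, ← e2]
      linear_combination -e3 / 2
    -- `W = z² w` is regular
    have mW : MeromorphicAt (fun t => z t ^ 2 * w t) c := by fun_prop
    have hWeq : ∀ᶠ t in 𝓝[≠] c, Z t * (t * deriv (fun t => z t ^ 2 * w t) t) =
        2 * (z t ^ 2 * w t) ^ 2 + 2 * t * (z t ^ 2 * w t) +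
        Z t * ((1 - 2 * a4 + 2 * a3) * (z t ^ 2 * w t) + a3 * Z t ^ 2 - 2 * a3 * S t) := by
      filter_upwards [heq, hzZ, hSe, mero_diff mz, mero_diff mw]
        with t ⟨_, _, e3, e4⟩ e1 e2 d1 d2
      rw [deriv_fun_mul (d1.fun_pow 2) d2, deriv_fun_pow d1, ← e1, ← e2]
      simp only [Nat.cast_ofNat, Nat.add_one_sub_one, pow_one]
      linear_combination (2 * z t ^ 2 * w t) * e3 + z t ^ 3 * e4
    obtain ⟨W, hW, hWe⟩ : ∃ g : ℂ → ℂ, AnalyticAt ℂ g c ∧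
        ∀ᶠ t in 𝓝[≠] c, z t ^ 2 * w t = g t := by
      rcases mero_dich mW with h | ⟨V, hV, hV0, hVe⟩
      · exact h
      exfalso
      have hVc := hV.continuousAt
      have hdVc := hV.deriv.continuousAt
      have key := eq_at (c := c) (F := fun t => - Z t * (t * deriv V t))
        (G := fun t => 2 + 2 * t * V t + Z t * ((1 - 2 * a4 + 2 * a3) * V t
          + a3 * Z t ^ 2 * V t ^ 2 - 2 * a3 * S t * V t ^ 2)) (by fun_prop) (by fun_prop) (by
          filter_upwards [hWeq, hVe, deriv_inv_ev mW hV hVe] with t e1 e2 e3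
          have e4 : deriv (fun t => z t ^ 2 * w t) t * V t ^ 2 = - deriv V t := by
            linear_combination V t * e3 - deriv V t * e2
          generalize deriv (fun t => z t ^ 2 * w t) t = dW at *
          generalize z t ^ 2 * w t = U at *
          linear_combination V t ^ 2 * e1 - Z t * t * e4 +
            (2 * (U * V t + 1) + 2 * t * V t + Z t * (1 - 2 * a4 + 2 * a3) * V t) * e2)
      simp [hZ0, hV0] at key
    have hWc := hW.continuousAt
    have hdWc := hW.deriv.continuousAt
    have hdW := deriv_ev hWe
    have hW0 : W c * (W c + c) = 0 := by
      have key := eq_at (c := c) (F := fun t => Z t * (t * deriv W t))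
        (G := fun t => 2 * W t ^ 2 + 2 * t * W t +
          Z t * ((1 - 2 * a4 + 2 * a3) * W t + a3 * Z t ^ 2 - 2 * a3 * S t))
        (by fun_prop) (by fun_prop) (by
          filter_upwards [hWeq, hWe, hdW] with t e1 e2 e3
          rw [← e2, ← e3, e1])
      simp only [hZ0] at key
      linear_combination -key / 2
    -- `Y = z² y`
    set Y : ℂ → ℂ := fun t => S t - W t with hYdef
    have hY : AnalyticAt ℂ Y c := by fun_prop
    have hYc := hY.continuousAt
    have hdYc := hY.deriv.continuousAt
    have hYe : ∀ᶠ t in 𝓝[≠] c, z t ^ 2 * y t = Y t := by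
      filter_upwards [hSe, hWe] with t e1 e2
      simp only [hYdef]
      linear_combination e1 - e2
    have hdY := deriv_ev hYe
    -- `X = x / z`
    have mX : MeromorphicAt (fun t => x t / z t) c := mx.fun_div mz
    have hXeq : ∀ᶠ t in 𝓝[≠] c, Z t * (t * deriv (fun t => x t / z t) t) =
        (1 - x t / z t) * (2 * W t + t - 2 * (x t / z t) * Y t + (x t / z t) * Z t ^ 2)
        - Z t * (2 * a2 + 2 * a3) * (x t / z t) + 2 * a3 * Z t := by
      filter_upwards [heq, hzZ, hWe, hYe, hz0, mero_diff mx, mero_diff mz]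
        with t ⟨e1, _, e3, _⟩ h1 h2 h3 h4 d1 d2
      rw [deriv_fun_div d1 d2 h4, ← h1, ← h2, ← h3]
      field_simp
      linear_combination z t * e1 - x t * e3
    have hX : Y c = 0 ∨ ∃ X0 : ℂ, Y c * (2 * W c + (2 - X0) * Y c + c) = 0 ∧
        (1 - X0) * (2 * W c + c - 2 * X0 * Y c) = 0 := by
      rcases mero_dich mX with ⟨X, hX, hXe⟩ | ⟨V, hV, hV0, hVe⟩
      · right
        have hXc := hX.continuousAt
        have hdXc := hX.deriv.continuousAt
        have hdX := deriv_ev hXe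
        refine ⟨X c, ?_, ?_⟩
        · have key := eq_at (c := c) (F := fun t => Z t * (t * deriv Y t))
            (G := fun t => 2 * Y t * (2 * W t + (2 - X t) * Y t + t) +
              Z t * ((2 * (1 - 2 * a4) - (1 - 2 * a2 - 2 * a3 - 2 * a4)) * Y t + a1 * Z t ^ 2
                - 2 * Y t * Z t + 2 * X t * Y t * Z t))
            (by fun_prop) (by fun_prop) (by
              filter_upwards [heq, hzZ, hWe, hYe, hdY, hXe, hz0, mero_diff my, mero_diff mz]
                with t ⟨_, e2, e3, _⟩ h1 h2 h3 h4 h5 h6 d1 d2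
              rw [← h4, deriv_fun_mul (d2.fun_pow 2) d1, deriv_fun_pow d2, ← h1, ← h2, ← h3, ← h5]
              simp only [Nat.cast_ofNat, Nat.add_one_sub_one, pow_one]
              field_simp
              linear_combination (2 * y t) * e3 + z t * e2)
          simp only [hZ0] at key
          linear_combination -key / 2
        · have key := eq_at (c := c) (F := fun t => Z t * (t * deriv X t))
            (G := fun t => (1 - X t) * (2 * W t + t - 2 * X t * Y t + X t * Z t ^ 2)
              - Z t * (2 * a2 + 2 * a3) * X t + 2 * a3 * Z t)
            (by fun_prop) (by fun_prop) (by
              filter_upwards [hXeq, hXe, hdX] with t e1 e2 e3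
              rw [← e2, ← e3, e1])
          simp only [hZ0] at key
          linear_combination -key
      · left
        have hVc := hV.continuousAt
        have hdVc := hV.deriv.continuousAt
        have key := eq_at (c := c) (F := fun t => - Z t * (t * deriv V t))
          (G := fun t => (V t - 1) * ((2 * W t + t) * V t - 2 * Y t + Z t ^ 2)
            - Z t * (2 * a2 + 2 * a3) * V t + 2 * a3 * Z t * V t ^ 2)
          (by fun_prop) (by fun_prop) (by
            filter_upwards [hXeq, hVe, deriv_inv_ev mX hV hVe] with t e1 e2 e3
            have e4 : deriv (fun t => x t / z t) t * V t ^ 2 = - deriv V t := by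
              linear_combination V t * e3 - deriv V t * e2
            generalize deriv (fun t => x t / z t) t = dX at *
            generalize x t / z t = U at *
            have hU : U = (V t)⁻¹ := eq_inv_of_mul_eq_one_left e2
            have hV' : V t ≠ 0 := right_ne_zero_of_mul_eq_one e2
            subst hU
            have : - Z t * (t * deriv V t) = V t ^ 2 * (Z t * (t * dX)) := by
              linear_combination -Z t * t * e4
            rw [this, e1]
            field_simp)
        simp only [hZ0, hV0] at key
        linear_combination -key / 2
    have hk : c * deriv Z c = 2 * S c + c := by
      simp only [hSdef, hZ0]; ring
    obtain ⟨hk0, n, hn⟩ := final_alg (S := S c) hc hk (by simp only [hYdef]; ring) hW0 hX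
    refine ⟨n, ?_⟩
    have hdZ0 : deriv Z c ≠ 0 := right_ne_zero_of_mul hk0
    -- slope of `Z`
    have hslope : Tendsto (fun t => (t - c)⁻¹ * Z t) (𝓝[≠] c) (𝓝 (deriv Z c)) := by
      have := hZ.differentiableAt.hasDerivAt.tendsto_slope
      refine this.congr' ?_
      filter_upwards with t
      simp [slope, hZ0]
    have hSt : Tendsto S (𝓝[≠] c) (𝓝 (S c)) := hSc.tendsto.mono_left nhdsWithin_le_nhds
    have hlim := hSt.div (hslope.pow 2) (pow_ne_zero 2 hdZ0)
    have hval : S c / deriv Z c ^ 2 = -(n * c) := by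
      rw [div_eq_iff (pow_ne_zero 2 hdZ0)]
      apply mul_right_cancel₀ hc
      linear_combination hn
    rw [hval] at hlim
    refine hlim.congr' ?_
    filter_upwards [hSe, hzZ, hz0, hne] with t e1 e2 e3 e4
    have e5 : t - c ≠ 0 := sub_ne_zero.mpr e4
    simp only [Pi.div_apply, Pi.pow_apply]
    rw [← e1, ← e2]
    field_simp

/-- If `F` is meromorphic and `(t-c)² F' → 0` then `(t-c) F → 0`. -/
lemma tendsto_of_deriv {F : ℂ → ℂ} {c : ℂ} (hF : MeromorphicAt F c)
    (h : Tendsto (fun t => (t - c) ^ 2 * deriv F t) (𝓝[≠] c) (𝓝 0)) :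
    Tendsto (fun t => (t - c) * F t) (𝓝[≠] c) (𝓝 0) := by
  have hcont : ∀ g : ℂ → ℂ, ContinuousAt g c → Tendsto g (𝓝[≠] c) (𝓝 (g c)) :=
    fun g hg => hg.tendsto.mono_left nhdsWithin_le_nhds
  rcases mero_dich hF with ⟨g, hg, hge⟩ | ⟨g, hg, hg0, hge⟩
  · have hgc := hg.continuousAt
    have h1 := hcont (fun t => (t - c) * g t) (by fun_prop)
    simp only [sub_self, zero_mul] at h1
    refine h1.congr' ?_
    filter_upwards [hge] with t ht
    rw [ht]
  · have hne : ∀ᶠ t in 𝓝[≠] c, t ≠ c := eventually_mem_nhdsWithin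
    have htop : analyticOrderAt g c ≠ ⊤ := by
      intro htop
      rw [analyticOrderAt_eq_top] at htop
      have h2 : ∀ᶠ t in 𝓝[≠] c, False := by
        filter_upwards [hge, htop.filter_mono nhdsWithin_le_nhds] with t h1 h2
        rw [h2] at h1
        simp at h1
      exact h2.exists.choose_spec
    obtain ⟨u, hu, huc, hgu⟩ := (hg.analyticOrderAt_ne_top).mp htop
    set m := analyticOrderNatAt g c
    have hm : m ≠ 0 := by
      intro hm
      have := hgu.self_of_nhds
      rw [hm, hg0] at this
      simp at this
      exact huc this.symm
    have huc' := hu.continuousAt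
    have hduc := hu.deriv.continuousAt
    have hgu' : ∀ᶠ t in 𝓝[≠] c, g t = (t - c) ^ m * u t := by
      filter_upwards [hgu.filter_mono nhdsWithin_le_nhds] with t ht
      simpa using ht
    have hdg := deriv_ev hgu'
    have hu0 : ∀ᶠ t in 𝓝[≠] c, u t ≠ 0 :=
      (huc'.eventually_ne huc).filter_mono nhdsWithin_le_nhds
    have h2 := hcont (fun t => (m : ℂ) + (t - c) * (deriv u t / u t))
      (by have := hduc.div huc' huc; fun_prop)
    simp only [sub_self, zero_mul, add_zero] at h2
    have h3 := h.div h2 (by exact_mod_cast hm)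
    rw [zero_div] at h3
    have h4 := h3.neg
    rw [neg_zero] at h4
    have hml : ∀ᶠ t in 𝓝[≠] c, (m : ℂ) + (t - c) * (deriv u t / u t) ≠ 0 :=
      h2.eventually_ne (by exact_mod_cast hm)
    refine h4.congr' ?_
    filter_upwards [hge, deriv_inv_ev hF hg hge, hgu', hdg, hu0, hne, ana_diff hu, hml] with
      t e1 e2 e3 e4 e5 e6 d e7
    have e8 : t - c ≠ 0 := sub_ne_zero.mpr e6
    have e9 : g t ≠ 0 := right_ne_zero_of_mul_eq_one e1
    have hdd : deriv (fun t => (t - c) ^ m * u t) t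
        = m * (t - c) ^ (m - 1) * u t + (t - c) ^ m * deriv u t := by
      rw [deriv_fun_mul (by fun_prop) d, deriv_fun_pow (by fun_prop)]
      simp
    have e10 : (t - c) * deriv g t = g t * ((m : ℂ) + (t - c) * (deriv u t / u t)) := by
      rw [e4, e3, hdd]
      obtain ⟨k, hk⟩ := Nat.exists_eq_succ_of_ne_zero hm
      rw [hk]
      simp only [Nat.succ_eq_add_one, Nat.add_sub_cancel, pow_succ]
      field_simp
    have e11 : deriv F t = - F t * deriv g t * F t := by
      linear_combination F t * e2 - deriv F t * e1
    simp only [Pi.neg_apply, Pi.div_apply]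
    rw [← neg_div, div_eq_iff e7, e11]
    linear_combination (t - c) * F t ^ 2 * e10 + (t - c) * F t *
      ((m : ℂ) + (t - c) * (deriv u t / u t)) * e1

lemma mero_HB4 {a1 a2 a3 a4 : ℂ} {x y z w : ℂ → ℂ} {c : ℂ}
    (mx : MeromorphicAt x c) (my : MeromorphicAt y c) (mz : MeromorphicAt z c)
    (mw : MeromorphicAt w c) : MeromorphicAt (HB4 a1 a2 a3 a4 x y z w) c := by
  unfold HB4
  fun_prop

lemma local_H {a0 a1 a2 a3 a4 : ℂ} {x y z w : ℂ → ℂ} {c : ℂ} (hc : c ≠ 0)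
    (mx : MeromorphicAt x c) (my : MeromorphicAt y c) (mz : MeromorphicAt z c)
    (mw : MeromorphicAt w c)
    (heq : ∀ᶠ t in 𝓝[≠] c, B4Eqs a0 a1 a2 a3 a4 x y z w t) :
    ∃ n : ℤ, Tendsto (fun t => (t - c) * HB4 a1 a2 a3 a4 x y z w t) (𝓝[≠] c) (𝓝 (n * c)) := by
  have hne : ∀ᶠ t in 𝓝[≠] c, t ≠ c := eventually_mem_nhdsWithin
  have ht0 : ∀ᶠ t in 𝓝[≠] c, t ≠ 0 :=
    (continuousAt_id.eventually_ne hc).filter_mono nhdsWithin_le_nhds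
  obtain ⟨n, hn⟩ := local_q hc mx my mz mw heq
  refine ⟨n, ?_⟩
  have mH : MeromorphicAt (HB4 a1 a2 a3 a4 x y z w) c := mero_HB4 mx my mz mw
  have hH' : ∀ᶠ t in 𝓝[≠] c, deriv (HB4 a1 a2 a3 a4 x y z w) t = y t + w t := by
    filter_upwards [heq, ht0, mero_diff mx, mero_diff my, mero_diff mz, mero_diff mw] with
      t ⟨e1, e2, e3, e4⟩ h0 d1 d2 d3 d4
    have D1 := d1.hasDerivAt
    have D2 := d2.hasDerivAt
    have D3 := d3.hasDerivAt
    have D4 := d4.hasDerivAt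
    have DD := ((((((((D1.fun_pow 2).fun_mul D2).fun_mul (D2.sub_const 1)).fun_add
      (D1.fun_mul ((D2.const_mul (1 - 2*a2 - 2*a3 - 2*a4)).sub_const a1))).fun_add
      ((hasDerivAt_id t).fun_mul D2)).fun_add
      (((D3.fun_pow 2).fun_mul D4).fun_mul (D4.sub_const 1))).fun_add
      (D3.fun_mul ((D4.const_mul (1 - 2*a4)).sub_const a3))).fun_add
      ((hasDerivAt_id t).fun_mul D4)).fun_add
      (((D2.const_mul 2).fun_mul D3).fun_mul ((D3.fun_mul D4).add_const a3))
    have DD' := DD.deriv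
    simp only [id] at DD'
    have : HB4 a1 a2 a3 a4 x y z w = fun t => x t ^ 2 * y t * (y t - 1)
        + x t * ((1 - 2*a2 - 2*a3 - 2*a4) * y t - a1) + t * y t
        + z t ^ 2 * w t * (w t - 1) + z t * ((1 - 2*a4) * w t - a3) + t * w t
        + 2 * y t * z t * (z t * w t + a3) := rfl
    rw [this, DD']
    apply mul_left_cancel₀ h0
    simp only [Nat.cast_ofNat, Nat.add_one_sub_one, pow_one]
    linear_combination (2 * x t * y t * (y t - 1) + (1 - 2*a2 - 2*a3 - 2*a4) * y t - a1) * e1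
      + (x t ^ 2 * (2 * y t - 1) + (1 - 2*a2 - 2*a3 - 2*a4) * x t + t
        + 2 * z t * (z t * w t + a3)) * e2
      + (2 * z t * w t * (w t - 1) + (1 - 2*a4) * w t - a3 + 4 * y t * z t * w t
        + 2 * a3 * y t) * e3
      + (z t ^ 2 * (2 * w t - 1) + (1 - 2*a4) * z t + t + 2 * y t * z t ^ 2) * e4
  have mF : MeromorphicAt (fun t => HB4 a1 a2 a3 a4 x y z w t - n * c / (t - c)) c := by
    fun_prop
  have h1 := tendsto_of_deriv mF (by
    have h2 := hn.add_const ((n : ℂ) * c)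
    rw [neg_add_cancel] at h2
    refine h2.congr' ?_
    filter_upwards [hH', mero_diff mH, hne] with t e1 d e2
    have e3 : t - c ≠ 0 := sub_ne_zero.mpr e2
    have e4 : HasDerivAt (fun t => (n : ℂ) * c / (t - c))
        ((0 * (t - c) - n * c * 1) / (t - c) ^ 2) t :=
      (hasDerivAt_const t _).fun_div ((hasDerivAt_id t).sub_const c) e3
    rw [deriv_fun_sub d e4.differentiableAt, e1, e4.deriv]
    field_simp
    ring)
  have h3 := h1.add_const ((n : ℂ) * c)
  rw [zero_add] at h3
  refine h3.congr' ?_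
  filter_upwards [hne] with t e2
  have e3 : t - c ≠ 0 := sub_ne_zero.mpr e2
  field_simp
  ring

/-- Coefficient extraction at `0`. -/
lemma coeff_zero_lim (M : ℕ) : ∀ (R : ℂ[X]) (h : ℂ),
    Tendsto (fun t => R.eval t / t ^ M) (𝓝[≠] 0) (𝓝 h) → R.coeff M = h := by
  have hcont : ∀ R : ℂ[X], Tendsto (fun t => R.eval t) (𝓝[≠] 0) (𝓝 (R.eval 0)) :=
    fun R => (R.continuous.tendsto 0).mono_left nhdsWithin_le_nhds
  have hne : ∀ᶠ t in 𝓝[≠] (0 : ℂ), t ≠ 0 := eventually_mem_nhdsWithin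
  induction M with
  | zero =>
    intro R h hR
    simp only [pow_zero, div_one] at hR
    rw [coeff_zero_eq_eval_zero]
    exact tendsto_nhds_unique (hcont R) hR
  | succ M ih =>
    intro R h hR
    have h0 : R.eval 0 = 0 := by
      have h1 : Tendsto (fun t : ℂ => t ^ (M + 1)) (𝓝[≠] 0) (𝓝 0) := by
        have := ((continuous_pow (M + 1)).tendsto (0 : ℂ)).mono_left
          (nhdsWithin_le_nhds (s := {0}ᶜ))
        simpa using this
      have h2 := hR.mul h1
      rw [mul_zero] at h2
      refine tendsto_nhds_unique (hcont R) (h2.congr' ?_)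
      filter_upwards [hne] with t ht
      field_simp
    have hX : R = X * R.divX := by
      have := R.X_mul_divX_add
      rw [coeff_zero_eq_eval_zero, h0] at this
      simpa using this.symm
    rw [hX, coeff_X_mul]
    apply ih
    refine hR.congr' ?_
    filter_upwards [hne] with t ht
    conv_lhs => rw [hX]
    rw [eval_mul, eval_X, pow_succ]
    field_simp

/-- Coefficient extraction at infinity. -/
lemma coeff_infty_lim (R : ℂ[X]) (M : ℕ) (h : ℂ)
    (hR : Tendsto (fun t => R.eval t / t ^ M) atInfty (𝓝 h)) : R.coeff M = h := by
  have hinf : atInfty = Bornology.cobounded ℂ := comap_norm_atTop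
  have : NeBot atInfty := by rw [hinf]; infer_instance
  have hnorm : Tendsto (fun t : ℂ => ‖t‖) atInfty atTop := tendsto_comap
  have hne : ∀ᶠ t in atInfty, t ≠ 0 := by
    filter_upwards [hnorm.eventually_gt_atTop 0] with t ht
    exact norm_pos_iff.mp ht
  induction M generalizing R with
  | zero =>
    simp only [pow_zero, div_one] at hR
    by_cases hd : 0 < R.degree
    · exact absurd hR.norm (not_tendsto_nhds_of_tendsto_atTop (R.tendsto_norm_atTop hd hnorm) _)
    · have h1 := eq_C_of_degree_le_zero (le_of_not_gt hd)
      rw [h1] at hR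
      simp only [eval_C] at hR
      exact tendsto_nhds_unique tendsto_const_nhds hR
  | succ M ih =>
    rw [← R.X_mul_divX_add, coeff_add, coeff_X_mul, coeff_C_succ, add_zero]
    apply ih
    have hi : Tendsto (fun t : ℂ => t⁻¹) atInfty (𝓝 0) := by
      rw [hinf]; exact tendsto_inv₀_cobounded
    have h2 : Tendsto (fun t : ℂ => R.coeff 0 * t⁻¹ ^ (M + 1)) atInfty (𝓝 0) := by
      have := (hi.pow (M + 1)).const_mul (R.coeff 0)
      simpa using this
    have h3 := hR.sub h2
    rw [sub_zero] at h3
    refine h3.congr' ?_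
    filter_upwards [hne] with t ht
    have hev : R.eval t = t * R.divX.eval t + R.coeff 0 := by
      conv_lhs => rw [← R.X_mul_divX_add]
      simp only [eval_add, eval_mul, eval_X, eval_C]
    rw [hev, inv_pow, pow_succ]
    have ht' : t ^ M ≠ 0 := pow_ne_zero M ht
    field_simp
    ring

/-- Equality with a rational function outside a finite set. -/
def RatEv (f : ℂ → ℂ) : Prop :=
  ∃ p q : ℂ[X], q ≠ 0 ∧ ∀ᶠ t in cofinite, f t = p.eval t / q.eval t

lemma ev_ne_zero {q : ℂ[X]} (hq : q ≠ 0) : ∀ᶠ t in cofinite, q.eval t ≠ 0 := by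
  have := (q.rootSet_finite ℂ).eventually_cofinite_notMem
  filter_upwards [this] with t ht h
  exact ht (by rw [mem_rootSet]; exact ⟨hq, by simpa using h⟩)

lemma RatEv.add {f g : ℂ → ℂ} (hf : RatEv f) (hg : RatEv g) : RatEv (fun t => f t + g t) := by
  obtain ⟨p, q, hq, h⟩ := hf
  obtain ⟨p', q', hq', h'⟩ := hg
  refine ⟨p * q' + p' * q, q * q', mul_ne_zero hq hq', ?_⟩
  filter_upwards [h, h', ev_ne_zero hq, ev_ne_zero hq'] with t e1 e2 e3 e4
  rw [e1, e2]
  simp only [eval_add, eval_mul]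
  field_simp

lemma RatEv.mul {f g : ℂ → ℂ} (hf : RatEv f) (hg : RatEv g) : RatEv (fun t => f t * g t) := by
  obtain ⟨p, q, hq, h⟩ := hf
  obtain ⟨p', q', hq', h'⟩ := hg
  refine ⟨p * p', q * q', mul_ne_zero hq hq', ?_⟩
  filter_upwards [h, h'] with t e1 e2
  rw [e1, e2]
  simp only [eval_mul]
  rw [div_mul_div_comm]

lemma RatEv.poly (p : ℂ[X]) : RatEv (fun t => p.eval t) :=
  ⟨p, 1, one_ne_zero, by simp⟩

lemma RatEv.const (a : ℂ) : RatEv (fun _ => a) := by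
  simpa using RatEv.poly (C a)

lemma RatEv.ident : RatEv (fun t => t) := by
  simpa using RatEv.poly X

lemma RatEv.sub {f g : ℂ → ℂ} (hf : RatEv f) (hg : RatEv g) : RatEv (fun t => f t - g t) := by
  have := hf.add ((RatEv.const (-1)).mul hg)
  simpa [sub_eq_add_neg] using this

lemma RatEv.pow {f : ℂ → ℂ} (hf : RatEv f) (n : ℕ) : RatEv (fun t => f t ^ n) := by
  induction n with
  | zero => simpa using RatEv.const 1
  | succ n ih => simpa [pow_succ] using ih.mul hf

lemma RatEv.sum {ι : Type*} (s : Finset ι) {f : ι → ℂ → ℂ} (hf : ∀ i ∈ s, RatEv (f i)) :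
    RatEv (fun t => ∑ i ∈ s, f i t) := by
  classical
  induction s using Finset.induction_on with
  | empty => simpa using RatEv.const 0
  | insert a s ha ih =>
    simp only [Finset.sum_insert ha]
    exact (hf a (Finset.mem_insert_self a s)).add
      (ih fun i hi => hf i (Finset.mem_insert_of_mem hi))

lemma ratEv_HB4 {a1 a2 a3 a4 : ℂ} {x y z w : ℂ → ℂ} (hx : RatEv x) (hy : RatEv y)
    (hz : RatEv z) (hw : RatEv w) : RatEv (HB4 a1 a2 a3 a4 x y z w) := by
  have c := RatEv.const
  unfold HB4
  refine RatEv.add (RatEv.add (RatEv.add (RatEv.add (RatEv.add (RatEv.add ?_ ?_) ?_) ?_) ?_) ?_) ?_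
  · exact ((hx.pow 2).mul hy).mul (hy.sub (c 1))
  · exact hx.mul (((c _).mul hy).sub (c _))
  · exact RatEv.ident.mul hy
  · exact ((hz.pow 2).mul hw).mul (hw.sub (c 1))
  · exact hz.mul (((c _).mul hw).sub (c _))
  · exact RatEv.ident.mul hw
  · exact (((c 2).mul hy).mul hz).mul ((hz.mul hw).add (c _))

lemma cofinite_nhdsNE (c : ℂ) : 𝓝[≠] c ≤ cofinite := by
  intro s hs
  have : IsClosed sᶜ := Set.Finite.isClosed (by simpa using hs)
  have h2 : (sᶜ \ {c})ᶜ ∈ 𝓝 c :=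
    (Set.Finite.isClosed (Set.Finite.subset (by simpa using hs) Set.sdiff_subset)).isOpen_compl.mem_nhds
      (by simp)
  filter_upwards [mem_nhdsWithin_of_mem_nhds h2, self_mem_nhdsWithin] with t h3 h4
  by_contra h5
  exact h3 ⟨h5, h4⟩

lemma cofinite_atInfty : atInfty ≤ cofinite := by
  have hinf : atInfty = Bornology.cobounded ℂ := comap_norm_atTop
  rw [hinf]
  exact Bornology.le_cofinite ℂ

lemma IsRatFn.ratEv {f : ℂ → ℂ} (hf : IsRatFn f) : RatEv f := by
  obtain ⟨p, q, hq, h⟩ := hf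
  exact ⟨p, q, hq, Eventually.of_forall h⟩

lemma IsRatFn.mero {f : ℂ → ℂ} (hf : IsRatFn f) (c : ℂ) : MeromorphicAt f c := by
  obtain ⟨p, q, hq, h⟩ := hf
  have : f = fun t => p.eval t / q.eval t := funext h
  rw [this]
  have hp : ∀ r : ℂ[X], MeromorphicAt (fun t => r.eval t) c := fun r =>
    (r.differentiable.analyticAt c).meromorphicAt
  exact (hp p).fun_div (hp q)

/-- A rational function whose nonzero poles are removed is a Laurent polynomial. -/
lemma laurent_of_removable {G : ℂ → ℂ} (hG : RatEv G)
    (h : ∀ c : ℂ, c ≠ 0 → Tendsto (fun t => (t - c) * G t) (𝓝[≠] c) (𝓝 0)) :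
    ∃ (P : ℂ[X]) (m : ℕ), ∀ᶠ t in cofinite, G t = P.eval t / t ^ m := by
  obtain ⟨p, q, hq, hpq⟩ := hG
  obtain ⟨d, p', q', hcop, hp', hq'⟩ : ∃ d p' q' : ℂ[X], IsCoprime p' q' ∧
      p = d * p' ∧ q = d * q' := by
    obtain ⟨p', h1⟩ := EuclideanDomain.gcd_dvd_left p q
    obtain ⟨q', h2⟩ := EuclideanDomain.gcd_dvd_right p q
    have hab := EuclideanDomain.gcd_eq_gcd_ab p q
    generalize EuclideanDomain.gcd p q = g at *
    generalize EuclideanDomain.gcdA p q = u at *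
    generalize EuclideanDomain.gcdB p q = v at *
    have hg : g ≠ 0 := by rintro rfl; simp at h2; exact hq h2
    refine ⟨g, p', q', ⟨u, v, ?_⟩, h1, h2⟩
    apply mul_left_cancel₀ hg
    linear_combination -hab - u * h1 - v * h2
  have hd : d ≠ 0 := by rintro rfl; simp at hq'; exact hq hq'
  have hq0 : q' ≠ 0 := by rintro rfl; simp at hq'; exact hq hq'
  have hG' : ∀ᶠ t in cofinite, G t = p'.eval t / q'.eval t := by
    filter_upwards [hpq, ev_ne_zero hd] with t e1 e2
    rw [e1, hp', hq', eval_mul, eval_mul, mul_div_mul_left _ _ e2]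
  have hroot : ∀ c, q'.IsRoot c → c = 0 := by
    intro c hc
    by_contra hc0
    obtain ⟨r, hr⟩ := dvd_iff_isRoot.mpr hc
    have hr0 : r ≠ 0 := by rintro rfl; simp at hr; exact hq0 hr
    have hcont : ∀ R : ℂ[X], Tendsto (fun t => R.eval t) (𝓝[≠] c) (𝓝 (R.eval c)) :=
      fun R => (R.continuous.tendsto c).mono_left nhdsWithin_le_nhds
    have h1 := (h c hc0).mul (hcont r)
    rw [zero_mul] at h1
    have hne : ∀ᶠ t in 𝓝[≠] c, t ≠ c := eventually_mem_nhdsWithin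
    have hpc : p'.eval c = 0 := by
      refine tendsto_nhds_unique (hcont p') (h1.congr' ?_)
      filter_upwards [hG'.filter_mono (cofinite_nhdsNE c),
        (ev_ne_zero hr0).filter_mono (cofinite_nhdsNE c), hne] with t e1 e2 e3
      have e4 : t - c ≠ 0 := sub_ne_zero.mpr e3
      rw [e1, hr]
      simp only [eval_mul, eval_sub, eval_X, eval_C]
      field_simp
    obtain ⟨u, v, huv⟩ := hcop
    have := congrArg (eval c) huv
    simp [hpc, hc.eq_zero] at this
  have hq1 : q' = C q'.leadingCoeff * X ^ q'.natDegree := by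
    have hs : q'.Splits := IsAlgClosed.splits q'
    have h1 := hs.eq_prod_roots
    have h2 : q'.roots = Multiset.replicate (Multiset.card q'.roots) 0 :=
      Multiset.eq_replicate_card.mpr fun b hb => hroot b (isRoot_of_mem_roots hb)
    rw [h2] at h1
    rw [← hs.natDegree_eq_card_roots] at h1
    simpa using h1
  have hlc : q'.leadingCoeff ≠ 0 := leadingCoeff_ne_zero.mpr hq0
  refine ⟨C q'.leadingCoeff⁻¹ * p', q'.natDegree, ?_⟩
  filter_upwards [hG'] with t e1
  rw [e1]
  conv_lhs => rw [hq1]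
  simp only [eval_mul, eval_C, eval_pow, eval_X]
  rw [inv_mul_eq_div, div_div]

/-- For a rational solution of the Sasano system `B₄⁽¹⁾`, the difference between the
constant terms of the Laurent expansions of the Hamiltonian at `t = ∞` and at `t = 0`
is an integer. -/
theorem B4_hamiltonian_const_terms_differ_by_integer (a0 a1 a2 a3 a4 : ℂ)
    (hsum : a0 + a1 + 2*a2 + 2*a3 + 2*a4 = 1) (x y z w : ℂ → ℂ)
    (hsol : IsRatSolB4 a0 a1 a2 a3 a4 x y z w) :
    ∀ hi h0 : ℂ, HasConstTermAtInfty (HB4 a1 a2 a3 a4 x y z w) hi →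
      HasConstTermAtZero (HB4 a1 a2 a3 a4 x y z w) h0 →
      ∃ n : ℤ, hi - h0 = n := by
  intro hi h0 hhi hh0
  obtain ⟨hx, hy, hz, hw, S, hS, heq⟩ := hsol
  have heq' : ∀ᶠ t in cofinite, B4Eqs a0 a1 a2 a3 a4 x y z w t := by
    filter_upwards [hS.eventually_cofinite_notMem] with t ht using heq t ht
  have hloc : ∀ c : ℂ, ∃ n : ℤ, c ≠ 0 →
      Tendsto (fun t => (t - c) * HB4 a1 a2 a3 a4 x y z w t) (𝓝[≠] c) (𝓝 (n * c)) := by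
    intro c
    by_cases hc : c = 0
    · exact ⟨0, fun h => absurd hc h⟩
    · obtain ⟨n, hn⟩ := local_H hc (hx.mero c) (hy.mero c) (hz.mero c) (hw.mero c)
        (heq'.filter_mono (cofinite_nhdsNE c))
      exact ⟨n, fun _ => hn⟩
  choose n hn using hloc
  have hratH : RatEv (HB4 a1 a2 a3 a4 x y z w) :=
    ratEv_HB4 hx.ratEv hy.ratEv hz.ratEv hw.ratEv
  generalize HB4 a1 a2 a3 a4 x y z w = H at *
  obtain ⟨p, q, hq, hpq⟩ := id hratH
  classical
  set T : Finset ℂ := q.roots.toFinset.erase 0 with hT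
  have hT0 : ∀ c ∈ T, c ≠ 0 := fun c hc => Finset.ne_of_mem_erase hc
  set F : ℂ → ℂ → ℂ := fun c t => (n c * c) / (t - c) with hF
  set G : ℂ → ℂ := fun t => H t - ∑ c ∈ T, F c t with hGdef
  have hG : RatEv G := by
    refine hratH.sub (RatEv.sum _ fun c _ => ?_)
    exact ⟨C (n c * c), X - C c, X_sub_C_ne_zero c, by simp [hF]⟩
  have hFcont : ∀ c d : ℂ, d ≠ c → Tendsto (fun t => (t - d) * F c t) (𝓝[≠] d) (𝓝 0) := by
    intro c d hcd
    have h1 : ContinuousAt (fun t => (t - d) * F c t) d := by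
      have : d - c ≠ 0 := sub_ne_zero.mpr hcd
      simp only [hF]
      fun_prop (disch := assumption)
    have h2 := h1.tendsto.mono_left (nhdsWithin_le_nhds (s := {d}ᶜ))
    simpa using h2
  have hFself : ∀ c : ℂ, Tendsto (fun t => (t - c) * F c t) (𝓝[≠] c) (𝓝 (n c * c)) := by
    intro c
    refine tendsto_const_nhds.congr' ?_
    have hne : ∀ᶠ t in 𝓝[≠] c, t ≠ c := eventually_mem_nhdsWithin
    filter_upwards [hne] with t ht
    have : t - c ≠ 0 := sub_ne_zero.mpr ht
    simp only [hF]
    field_simp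
  have hGrem : ∀ d : ℂ, d ≠ 0 → Tendsto (fun t => (t - d) * G t) (𝓝[≠] d) (𝓝 0) := by
    intro d hd
    have hsumlim : Tendsto (fun t => ∑ c ∈ T, (t - d) * F c t) (𝓝[≠] d)
        (𝓝 (∑ c ∈ T, if c = d then n c * c else 0)) := by
      refine tendsto_finsetSum _ fun c _ => ?_
      by_cases hcd : c = d
      · subst hcd; simpa using hFself c
      · simpa [hcd] using hFcont c d (Ne.symm hcd)
    have hHlim : Tendsto (fun t => (t - d) * H t) (𝓝[≠] d)
        (𝓝 (∑ c ∈ T, if c = d then n c * c else 0)) := by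
      rw [Finset.sum_ite_eq' T d]
      split_ifs with hdT
      · exact hn d hd
      · have hqd : q.eval d ≠ 0 := by
          intro h
          exact hdT (by simp [hT, hd, hq, h])
        have h1 : ContinuousAt (fun t => (t - d) * (p.eval t / q.eval t)) d := by
          have := p.continuous.continuousAt (x := d)
          have := q.continuous.continuousAt (x := d)
          fun_prop (disch := assumption)
        have h2 := h1.tendsto.mono_left (nhdsWithin_le_nhds (s := {d}ᶜ))
        simp only [sub_self, zero_mul] at h2
        refine h2.congr' ?_
        filter_upwards [hpq.filter_mono (cofinite_nhdsNE d)] with t ht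
        rw [ht]
    have := hHlim.sub hsumlim
    rw [sub_self] at this
    refine this.congr fun t => ?_
    simp only [hGdef, mul_sub, Finset.mul_sum]
  obtain ⟨P, m, hP⟩ := laurent_of_removable hG hGrem
  -- constant term at infinity
  have hinf : atInfty = Bornology.cobounded ℂ := comap_norm_atTop
  have hFinf : Tendsto (fun t => ∑ c ∈ T, F c t) atInfty (𝓝 0) := by
    rw [show (0 : ℂ) = ∑ c ∈ T, 0 by simp]
    refine tendsto_finsetSum _ fun c _ => ?_
    have h1 : Tendsto (fun t : ℂ => t - c) atInfty (Bornology.cobounded ℂ) := by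
      rw [hinf]
      simpa [sub_eq_add_neg] using tendsto_add_const_cobounded (-c)
    have h2 := (tendsto_inv₀_cobounded.comp h1).const_mul (n c * c : ℂ)
    simpa [hF, div_eq_mul_inv, Function.comp_def] using h2
  have hne_inf : ∀ᶠ t in atInfty, t ≠ 0 :=
    cofinite_atInfty (by simp : {t : ℂ | t ≠ 0} ∈ cofinite)
  have hPi : P.coeff m = hi := by
    obtain ⟨r, hr0, hr⟩ := hhi
    have h1 := hr.sub hFinf
    rw [sub_zero] at h1
    have h2 := coeff_infty_lim (P - X ^ m * r) m hi (by
      refine h1.congr' ?_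
      filter_upwards [hP.filter_mono cofinite_atInfty, hne_inf] with t e1 e2
      simp only [hGdef] at e1
      simp only [eval_sub, eval_mul, eval_pow, eval_X]
      rw [sub_div, ← e1]
      field_simp
      ring)
    rw [← h2, coeff_sub]
    have := coeff_X_pow_mul r m 0
    rw [zero_add] at this
    rw [this, hr0, sub_zero]
  -- constant term at zero
  have hFzero : Tendsto (fun t => ∑ c ∈ T, F c t) (𝓝[≠] 0) (𝓝 (∑ c ∈ T, -(n c : ℂ))) := by
    refine tendsto_finsetSum _ fun c hc => ?_
    have hc0 := hT0 c hc
    have h1 : ContinuousAt (F c) 0 := by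
      have : (0 : ℂ) - c ≠ 0 := by simpa using hc0
      simp only [hF]
      fun_prop (disch := assumption)
    have h2 := h1.tendsto.mono_left (nhdsWithin_le_nhds (s := {0}ᶜ))
    have h3 : F c 0 = -(n c : ℂ) := by
      simp only [hF, zero_sub]
      field_simp
    rwa [h3] at h2
  have hPz : P.coeff m = h0 - ∑ c ∈ T, -(n c : ℂ) := by
    obtain ⟨N, a, ha⟩ := hh0
    have h1 := ha.sub hFzero
    have h2 := coeff_zero_lim (m + N) (X ^ N * P - X ^ m *
        ∑ k ∈ Finset.range N, C (a k) * X ^ (N - (k + 1))) _ (by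
      refine h1.congr' ?_
      have hne : ∀ᶠ t in 𝓝[≠] (0 : ℂ), t ≠ 0 := eventually_mem_nhdsWithin
      filter_upwards [hP.filter_mono (cofinite_nhdsNE 0), hne] with t e1 e2
      simp only [hGdef] at e1
      simp only [eval_sub, eval_mul, eval_pow, eval_X, eval_finsetSum, eval_C]
      have e3 : ∑ k ∈ Finset.range N, a k / t ^ (k + 1)
          = (∑ k ∈ Finset.range N, a k * t ^ (N - (k + 1))) / t ^ N := by
        rw [Finset.sum_div]
        refine Finset.sum_congr rfl fun k hk => ?_
        have hk' : k + 1 ≤ N := Finset.mem_range.mp hk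
        rw [div_eq_div_iff (pow_ne_zero _ e2) (pow_ne_zero _ e2), mul_assoc, ← pow_add,
          Nat.sub_add_cancel hk']
      rw [e3, sub_right_comm, e1, pow_add]
      field_simp)
    rw [← h2, coeff_sub, add_comm m N, coeff_X_pow_mul', add_comm N m, coeff_X_pow_mul']
    simp only [Nat.le_add_left, Nat.le_add_right, if_true, Nat.add_sub_cancel,
      Nat.add_sub_cancel_left, finsetSum_coeff, coeff_C_mul, coeff_X_pow]
    rw [Finset.sum_eq_zero, sub_zero]
    intro k hk
    have hk' := Finset.mem_range.mp hk
    rw [if_neg (by omega), mul_zero]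
  refine ⟨∑ c ∈ T, n c, ?_⟩
  rw [← hPi, hPz]
  push_cast
  rw [Finset.sum_neg_distrib]
  ring
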